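/- Let (J₁, J₂) be a linear generalized Kähler structure on 𝕍 = V × V* with G = −J₁∘J₂, and let K ⊆ V* be an m-dimensional subspace satisfying, for j = 1, 2: (1) K + J_j(K) ⊆ Ann(K + J_j(K)); (2) J_j(K) ∩ V* = {0}; and (3) a(J₁(K)) ∩ a(J₂(K)) = {0}. Let K' ⊆ J₁(K) + J₂(K) be an isotropic subspace with dim K' = m (a maximal isotropic subspace of J₁(K) ⊕ J₂(K) for the restricted pairing). Then K' ∩ V* = {0}, K + K' ⊆ Ann(K + K'), K' ∩ G(K') = {0}, K' + G(K') = J₁(K) + J₂(K), and consequently Ann(K + K' + G(K') + G(K)) = Ann(K + J₁(K) + J₂(K) + G(K)). (First part of Lemma dual:linear.) -/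

import Mathlib

/-- The generalized tangent space `𝕍 = V × V*`. -/
abbrev GV (V : Type*) [AddCommGroup V] [Module ℝ V] := V × Module.Dual ℝ V

variable (V : Type*) [AddCommGroup V] [Module ℝ V] [FiniteDimensional ℝ V]

/-- The canonical symmetric pairing `⟨(X,ξ),(Y,η)⟩ = (1/2)(η X + ξ Y)` on `𝕍`. -/
noncomputable def pairForm : LinearMap.BilinForm ℝ (GV V) :=
  LinearMap.mk₂ ℝ (fun u v => (1 / 2 : ℝ) * (v.2 u.1 + u.2 v.1))
    (fun u u' v => by simp; ring)
    (fun c u v => by simp; ring)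
    (fun u v v' => by simp; ring)
    (fun c u v => by simp; ring)

/-- `V* = {0} × V*` as a subspace of `𝕍`. -/
def VStar : Submodule ℝ (GV V) := LinearMap.range (LinearMap.inr ℝ V (Module.Dual ℝ V))

variable {V}

/-- The annihilator of a subspace of `𝕍` with respect to the canonical pairing. -/
noncomputable def Ann (S : Submodule ℝ (GV V)) : Submodule ℝ (GV V) where
  carrier := {u : GV V | ∀ s ∈ S, pairForm V u s = 0}
  add_mem' := fun ha hb s hs => by simp [ha s hs, hb s hs]
  zero_mem' := fun s hs => by simp
  smul_mem' := fun c a ha s hs => by simp [ha s hs]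

/-- The image in `𝕍` of a subspace `K ⊆ V*`. -/
def ofDual (K : Submodule ℝ (Module.Dual ℝ V)) : Submodule ℝ (GV V) :=
  K.map (LinearMap.inr ℝ V (Module.Dual ℝ V))

/-- A linear generalized complex structure on `𝕍`. -/
structure IsGenCx (J : GV V →ₗ[ℝ] GV V) : Prop where
  sq : ∀ u, J (J u) = -u
  orth : ∀ u v, pairForm V (J u) (J v) = pairForm V u v

/-- A linear generalized Kähler structure on `𝕍`: two commuting linear generalized
complex structures such that `G = -J₁∘J₂` gives a positive definite form `⟨G·,·⟩`. -/
structure IsGenKahler (J₁ J₂ : GV V →ₗ[ℝ] GV V) : Prop where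
  cx1 : IsGenCx J₁
  cx2 : IsGenCx J₂
  comm : ∀ u, J₁ (J₂ u) = J₂ (J₁ u)
  posdef : ∀ u : GV V, u ≠ 0 → 0 < pairForm V (-(J₁ (J₂ u))) u

theorem pairForm_comm {V : Type*} [AddCommGroup V] [Module ℝ V]
    [FiniteDimensional ℝ V] (u v : GV V) : pairForm V u v = pairForm V v u := by
  simp only [pairForm, LinearMap.mk₂_apply]
  ring

theorem mem_VStar_iff {V : Type*} [AddCommGroup V] [Module ℝ V] [FiniteDimensional ℝ V]
    (u : GV V) : u ∈ VStar V ↔ u.1 = 0 := by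
  constructor
  · rintro ⟨ξ, rfl⟩
    rfl
  · intro hu
    exact ⟨u.2, Prod.ext hu.symm rfl⟩

/-- If `P` and `Q` meet `V*` trivially and have independent projections to `V`, then `P + Q`
meets `V*` trivially. -/
theorem sup_inf_VStar_eq_bot {V : Type*} [AddCommGroup V] [Module ℝ V]
    [FiniteDimensional ℝ V] {P Q : Submodule ℝ (GV V)}
    (hP : P ⊓ VStar V = ⊥) (hQ : Q ⊓ VStar V = ⊥)
    (hPQ : P.map (LinearMap.fst ℝ V (Module.Dual ℝ V)) ⊓
      Q.map (LinearMap.fst ℝ V (Module.Dual ℝ V)) = ⊥) :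
    (P ⊔ Q) ⊓ VStar V = ⊥ := by
  rw [Submodule.eq_bot_iff]
  rintro x ⟨hx, hxV⟩
  obtain ⟨p, hp, q, hq, rfl⟩ := Submodule.mem_sup.1 hx
  have hsum : p.1 + q.1 = 0 := (mem_VStar_iff _).1 hxV
  have hp1 : p.1 = 0 := by
    have : p.1 ∈ P.map (LinearMap.fst ℝ V (Module.Dual ℝ V)) ⊓
        Q.map (LinearMap.fst ℝ V (Module.Dual ℝ V)) :=
      ⟨⟨p, hp, rfl⟩, ⟨-q, Q.neg_mem hq, (eq_neg_of_add_eq_zero_left hsum).symm⟩⟩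
    rwa [hPQ, Submodule.mem_bot] at this
  have hq1 : q.1 = 0 := by rwa [hp1, zero_add] at hsum
  have hp0 : p = 0 := (Submodule.eq_bot_iff _).1 hP p ⟨hp, (mem_VStar_iff _).2 hp1⟩
  have hq0 : q = 0 := (Submodule.eq_bot_iff _).1 hQ q ⟨hq, (mem_VStar_iff _).2 hq1⟩
  rw [hp0, hq0, add_zero]

theorem le_Ann_comm {V : Type*} [AddCommGroup V] [Module ℝ V] [FiniteDimensional ℝ V]
    {S T : Submodule ℝ (GV V)} : S ≤ Ann T ↔ T ≤ Ann S :=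
  ⟨fun h t ht s hs => (pairForm_comm t s).trans (h hs t ht),
    fun h s hs t ht => (pairForm_comm s t).trans (h ht s hs)⟩

theorem le_Ann_sup {V : Type*} [AddCommGroup V] [Module ℝ V] [FiniteDimensional ℝ V]
    {S T U : Submodule ℝ (GV V)} (hT : S ≤ Ann T) (hU : S ≤ Ann U) : S ≤ Ann (T ⊔ U) :=
  le_Ann_comm.2 (sup_le (le_Ann_comm.1 hT) (le_Ann_comm.1 hU))

theorem Ann_anti {V : Type*} [AddCommGroup V] [Module ℝ V] [FiniteDimensional ℝ V]
    {S T : Submodule ℝ (GV V)} (hST : S ≤ T) : Ann T ≤ Ann S :=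
  fun _ hu s hs => hu s (hST hs)

/-- first part of Lemma dual:linear: for a maximal isotropic
`K' ⊆ J₁(K) + J₂(K)` (with `dim K' = m`), one has `K' ∩ V* = 0`,
`K + K' ⊆ Ann(K + K')`, `K' ∩ G(K') = 0`, `K' + G(K') = J₁(K) + J₂(K)`, and
`Ann(K + K' + G(K') + G(K)) = Ann(K + J₁(K) + J₂(K) + G(K))`. -/
theorem statement16 {V : Type*} [AddCommGroup V] [Module ℝ V] [FiniteDimensional ℝ V]
    (J₁ J₂ : GV V →ₗ[ℝ] GV V) (h : IsGenKahler J₁ J₂)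
    (K : Submodule ℝ (Module.Dual ℝ V))
    (h1 : ofDual K ⊔ (ofDual K).map J₁ ≤ Ann (ofDual K ⊔ (ofDual K).map J₁))
    (h1' : ofDual K ⊔ (ofDual K).map J₂ ≤ Ann (ofDual K ⊔ (ofDual K).map J₂))
    (h2 : (ofDual K).map J₁ ⊓ VStar V = ⊥)
    (h2' : (ofDual K).map J₂ ⊓ VStar V = ⊥)
    (h3 : ((ofDual K).map J₁).map (LinearMap.fst ℝ V (Module.Dual ℝ V)) ⊓
          ((ofDual K).map J₂).map (LinearMap.fst ℝ V (Module.Dual ℝ V)) = ⊥)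
    (K' : Submodule ℝ (GV V))
    (hK'le : K' ≤ (ofDual K).map J₁ ⊔ (ofDual K).map J₂)
    (hK'iso : ∀ x ∈ K', ∀ y ∈ K', pairForm V x y = 0)
    (hK'dim : Module.finrank ℝ K' = Module.finrank ℝ K) :
    let G : GV V →ₗ[ℝ] GV V := -(J₁ ∘ₗ J₂)
    let Kv : Submodule ℝ (GV V) := ofDual K
    K' ⊓ VStar V = ⊥ ∧
    Kv ⊔ K' ≤ Ann (Kv ⊔ K') ∧
    K' ⊓ K'.map G = ⊥ ∧
    K' ⊔ K'.map G = Kv.map J₁ ⊔ Kv.map J₂ ∧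
    Ann (Kv ⊔ K' ⊔ K'.map G ⊔ Kv.map G)
      = Ann (Kv ⊔ Kv.map J₁ ⊔ Kv.map J₂ ⊔ Kv.map G) := by
  intro G Kv
  have hGpos : ∀ u : GV V, pairForm V (G u) u = 0 → u = 0 := fun u hu => by
    by_contra hne
    exact (h.posdef u hne).ne' hu
  have hG1 : ∀ u, G (J₁ u) = J₂ u := fun u => by
    simp [G, ← h.comm, h.cx1.sq]
  have hG2 : ∀ u, G (J₂ u) = J₁ u := fun u => by
    simp [G, h.cx2.sq]
  have hGinj : Function.Injective G := by
    rw [injective_iff_map_eq_zero]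
    intro u hu
    exact hGpos u (by simp [hu])
  have hGmap : K'.map G ≤ Kv.map J₁ ⊔ Kv.map J₂ := by
    refine (Submodule.map_mono hK'le).trans ?_
    rw [Submodule.map_sup]
    refine sup_le ?_ ?_
    · rintro _ ⟨_, ⟨k, hk, rfl⟩, rfl⟩
      rw [hG1]
      exact Submodule.mem_sup_right ⟨k, hk, rfl⟩
    · rintro _ ⟨_, ⟨k, hk, rfl⟩, rfl⟩
      rw [hG2]
      exact Submodule.mem_sup_left ⟨k, hk, rfl⟩
  have hdisj : K' ⊓ K'.map G = ⊥ := by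
    rw [Submodule.eq_bot_iff]
    rintro _ ⟨hx, y, hy, rfl⟩
    rw [hGpos y (hK'iso _ hx _ hy), map_zero]
  have hKv : Module.finrank ℝ Kv = Module.finrank ℝ K :=
    (Submodule.equivMapOfInjective _ LinearMap.inr_injective K).finrank_eq.symm
  have hsup : K' ⊔ K'.map G = Kv.map J₁ ⊔ Kv.map J₂ := by
    refine Submodule.eq_of_le_of_finrank_le (sup_le hK'le hGmap) ?_
    have hdim := Submodule.finrank_sup_add_finrank_inf_eq K' (K'.map G)
    have hmap : Module.finrank ℝ (K'.map G) = Module.finrank ℝ K' :=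
      (Submodule.equivMapOfInjective G hGinj K').finrank_eq.symm
    rw [hdisj, finrank_bot, hmap] at hdim
    have hle := Submodule.finrank_add_le_finrank_add_finrank (Kv.map J₁) (Kv.map J₂)
    have hle1 := Submodule.finrank_map_le J₁ Kv
    have hle2 := Submodule.finrank_map_le J₂ Kv
    omega
  have hKK : Kv ≤ Ann Kv := le_sup_left.trans (h1.trans (Ann_anti le_sup_left))
  have hKK' : Kv ≤ Ann K' :=
    (le_Ann_sup (le_sup_left.trans (h1.trans (Ann_anti le_sup_right)))
      (le_sup_left.trans (h1'.trans (Ann_anti le_sup_right)))).trans (Ann_anti hK'le)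
  refine ⟨?_, ?_, hdisj, hsup, ?_⟩
  · exact le_bot_iff.1 ((inf_le_inf_right _ hK'le).trans (sup_inf_VStar_eq_bot h2 h2' h3).le)
  · exact sup_le (le_Ann_sup hKK hKK') (le_Ann_sup (le_Ann_comm.1 hKK') hK'iso)
  · rw [sup_assoc Kv K', hsup, ← sup_assoc Kv]
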